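/- Let S and A be finite nonempty sets, let Q*, Q̂ : S × A → ℝ, and let π*, π̂ : S → A be greedy policies for Q* and Q̂ respectively (i.e., for every s, Q*(s, π*(s)) = max_{a ∈ A} Q*(s,a) and Q̂(s, π̂(s)) = max_{a ∈ A} Q̂(s,a)). Let (Ω, 𝔽, P) be a probability space, let X : Ω → S be a random variable, and let c ≥ 0. If E[(Q̂(X, π*(X)) − Q*(X, π*(X)))²] ≤ c and E[(Q̂(X, π̂(X)) − Q*(X, π̂(X)))²] ≤ c, then E[Q*(X, π*(X)) − Q*(X, π̂(X))] ≤ 2√c. -/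

import Mathlib

open MeasureTheory

theorem aux_integrable {S : Type*} [Fintype S] [MeasurableSpace S] [MeasurableSingletonClass S]
    {Ω : Type*} [MeasurableSpace Ω] (μ : Measure Ω) [IsProbabilityMeasure μ]
    (X : Ω → S) (hX : Measurable X) (f : S → ℝ) : Integrable (fun ω => f (X ω)) μ := by
  have : IsFiniteMeasure (μ.map X) := inferInstance
  exact (Integrable.of_finite (μ := μ.map X) (f := f)).comp_measurable hX

theorem aux_bound {S : Type*} [Fintype S] [MeasurableSpace S] [MeasurableSingletonClass S]
    {Ω : Type*} [MeasurableSpace Ω] (μ : Measure Ω) [IsProbabilityMeasure μ]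
    (X : Ω → S) (hX : Measurable X) (f : S → ℝ) (c : ℝ)
    (h : ∫ ω, (f (X ω)) ^ 2 ∂μ ≤ c) : |∫ ω, f (X ω) ∂μ| ≤ Real.sqrt c := by
  apply Real.abs_le_sqrt
  refine le_trans ?_ h
  set m := ∫ ω, f (X ω) ∂μ with hm
  have i1 := aux_integrable μ X hX f
  have i2 := aux_integrable μ X hX (fun s => f s ^ 2)
  have i3 := aux_integrable μ X hX (fun s => 2 * m * f s - m ^ 2)
  have key : ∫ ω, (2 * m * f (X ω) - m ^ 2) ∂μ ≤ ∫ ω, (f (X ω)) ^ 2 ∂μ :=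
    integral_mono i3 i2 (fun ω => by
      change 2 * m * f (X ω) - m ^ 2 ≤ f (X ω) ^ 2
      nlinarith [sq_nonneg (f (X ω) - m)])
  rw [integral_sub (i1.const_mul _) (integrable_const _), integral_const_mul, ← hm] at key
  simp at key
  nlinarith

/-- **Per-time-step expectation bound** (proof of Proposition 4.2).
`S`, `A` finite nonempty, `π*` greedy for `Q*`, `π̂` greedy for `Q̂` (greedy meaning
`Q(s, π(s)) = max_a Q(s,a)` for all `s`). If the mean-squared calibration bounds
`E[(Q̂(X,π*(X)) − Q*(X,π*(X)))²] ≤ c` and `E[(Q̂(X,π̂(X)) − Q*(X,π̂(X)))²] ≤ c` hold on a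
probability space, then `E[Q*(X,π*(X)) − Q*(X,π̂(X))] ≤ 2√c`. -/
theorem per_step_expectation_bound
    {S A : Type*} [Fintype S] [Nonempty S] [Fintype A] [Nonempty A]
    [MeasurableSpace S] [MeasurableSingletonClass S]
    {Ω : Type*} [MeasurableSpace Ω] (μ : Measure Ω) [IsProbabilityMeasure μ]
    (Qstar Qhat : S × A → ℝ) (pistar pihat : S → A)
    (hpistar : ∀ s, Qstar (s, pistar s) = ⨆ a, Qstar (s, a))
    (hpihat : ∀ s, Qhat (s, pihat s) = ⨆ a, Qhat (s, a))
    (X : Ω → S) (hX : Measurable X)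
    (c : ℝ) (hc : 0 ≤ c)
    (h1 : ∫ ω, (Qhat (X ω, pistar (X ω)) - Qstar (X ω, pistar (X ω))) ^ 2 ∂μ ≤ c)
    (h2 : ∫ ω, (Qhat (X ω, pihat (X ω)) - Qstar (X ω, pihat (X ω))) ^ 2 ∂μ ≤ c) :
    ∫ ω, (Qstar (X ω, pistar (X ω)) - Qstar (X ω, pihat (X ω))) ∂μ ≤ 2 * Real.sqrt c := by
  have b1 := aux_bound μ X hX (fun s => Qhat (s, pistar s) - Qstar (s, pistar s)) c h1
  have b2 := aux_bound μ X hX (fun s => Qhat (s, pihat s) - Qstar (s, pihat s)) c h2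
  have i0 := aux_integrable μ X hX (fun s => Qstar (s, pistar s) - Qstar (s, pihat s))
  have i1 := aux_integrable μ X hX (fun s => Qhat (s, pistar s) - Qstar (s, pistar s))
  have i2 := aux_integrable μ X hX (fun s => Qhat (s, pihat s) - Qstar (s, pihat s))
  have key := integral_mono i0 (i2.sub i1) (fun ω => by
    have h : Qhat (X ω, pistar (X ω)) ≤ Qhat (X ω, pihat (X ω)) := by
      rw [hpihat]
      exact le_ciSup (f := fun a => Qhat (X ω, a)) (Set.finite_range _).bddAbove (pistar (X ω))
    simp only [Pi.sub_apply]
    linarith)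
  rw [integral_sub' i2 i1] at key
  have := (abs_le.1 b1).1
  have := (abs_le.1 b2).2
  linarith
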